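/- arXiv:1507.00377 — 2 statements merged into one kernel-verified Lean document; each statement's English description precedes it below -/
import Mathlib

section
/- Let F be an algebraically closed field and n ≥ 1. If A is a subalgebra of M_n(F) that is irreducible (no nontrivial invariant subspace and A ≠ {0}), then A = M_n(F). (Burnside's Theorem.) -/
theorem burnside_end {F V : Type*} [Field F] [IsAlgClosed F] [AddCommGroup V] [Module F V]
    [FiniteDimensional F V] [Nontrivial V] (B : Subalgebra F (Module.End F V))
    (h : ∀ W : Submodule F V, (∀ b ∈ B, ∀ x ∈ W, b x ∈ W) → W = ⊥ ∨ W = ⊤)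
    (f : Module.End F V) : f ∈ B := by
  classical
  haveI : IsSimpleModule B V := by
    rw [isSimpleModule_iff]
    refine { eq_bot_or_eq_top := fun W => ?_ }
    rcases h (W.restrictScalars F) (fun b hb x hx => W.smul_mem (⟨b, hb⟩ : B) hx) with h1 | h1
    · left
      simpa using h1
    · right
      simpa using h1
  have hs := (IsSimpleModule.algebraMap_end_bijective_of_isAlgClosed (A := B) (V := V) F).2
  let g : Module.End (Module.End B V) V :=
    { toFun := f
      map_add' := f.map_add
      map_smul' := by
        intro c x
        obtain ⟨t, rfl⟩ := hs c
        simp }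
  obtain ⟨s, hs⟩ := Module.Finite.fg_top (R := F) (M := V)
  obtain ⟨r, hr⟩ := jacobson_density (R := B) g s
  have : f = r.1 := by
    apply LinearMap.ext_on hs
    intro m hm
    exact hr m hm
  rw [this]
  exact r.2

/-- Burnside's Theorem: over an algebraically closed field `F`,
the only irreducible subalgebra of `M_n(F)` is `M_n(F)` itself. -/
theorem stmt2 {F : Type*} [Field F] [IsAlgClosed F] {n : ℕ} (hn : 1 ≤ n)
    (𝒜 : NonUnitalSubalgebra F (Matrix (Fin n) (Fin n) F))
    (hne : ∃ A ∈ 𝒜, A ≠ 0)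
    (hirr : ∀ W : Submodule F (Fin n → F),
      (∀ A ∈ 𝒜, ∀ x ∈ W, A.mulVec x ∈ W) → W = ⊥ ∨ W = ⊤) :
    𝒜 = ⊤ := by
  haveI : Nonempty (Fin n) := ⟨⟨0, hn⟩⟩
  let e := Matrix.toLinAlgEquiv' (R := F) (n := Fin n)
  have hB := burnside_end ((Algebra.adjoin F (𝒜 : Set (Matrix (Fin n) (Fin n) F))).map e.toAlgHom)
    (fun W hW => hirr W fun A hA x hx => by
      have := hW (e A) ⟨A, Algebra.subset_adjoin hA, rfl⟩ x hx
      simpa [e] using this)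
  have hB' : ∀ M, M ∈ Algebra.adjoin F (𝒜 : Set (Matrix (Fin n) (Fin n) F)) := by
    intro M
    obtain ⟨N, hN, h⟩ := hB (e M)
    have : N = M := e.injective h
    exact this ▸ hN
  have key : ∀ M, ∀ A ∈ 𝒜, M * A ∈ 𝒜 ∧ A * M ∈ 𝒜 := by
    intro M
    induction hB' M using Algebra.adjoin_induction with
    | mem x hx => exact fun A hA => ⟨𝒜.mul_mem hx hA, 𝒜.mul_mem hA hx⟩
    | algebraMap r =>
      intro A hA
      rw [← Algebra.commutes, ← Algebra.smul_def]
      exact ⟨𝒜.smul_mem r hA, 𝒜.smul_mem r hA⟩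
    | add x y _ _ hx hy =>
      intro A hA
      rw [add_mul, mul_add]
      exact ⟨𝒜.add_mem (hx A hA).1 (hy A hA).1, 𝒜.add_mem (hx A hA).2 (hy A hA).2⟩
    | mul x y _ _ hx hy =>
      intro A hA
      rw [mul_assoc, ← mul_assoc A]
      exact ⟨(hx _ (hy A hA).1).1, (hy _ (hx A hA).2).2⟩
  let I : TwoSidedIdeal (Matrix (Fin n) (Fin n) F) := .mk' (𝒜 : Set _) 𝒜.zero_mem
    (fun hx hy => 𝒜.add_mem hx hy) (fun hx => neg_mem (S := NonUnitalSubalgebra F _) hx)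
    (fun {x y} hy => (key x y hy).1) (fun {x y} hx => (key y x hx).2)
  have hI : ∀ x, x ∈ I ↔ x ∈ 𝒜 := fun x => TwoSidedIdeal.mem_mk' ..
  rcases eq_bot_or_eq_top I with h | h
  · obtain ⟨A, hA, h0⟩ := hne
    have := (hI A).2 hA
    rw [h] at this
    exact absurd ((TwoSidedIdeal.mem_bot _).1 this) h0
  · rw [eq_top_iff]
    intro x _
    rw [← hI, h]
    trivial
end

section
/- Let F be a field, n > 1, S an irreducible multiplicative semigroup in M_n(F), and J a nonzero semigroup ideal of S. If A ∈ Alg_F(S ∪ {I}) satisfies (J₁ A J₂)^n = 0 for all J₁, J₂ ∈ J, then A = 0. -/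
open Module in
theorem aux_burnside {A V : Type*} (k : Type*) [Field k] [Ring A] [Algebra k A] [AddCommGroup V]
    [Module k V] [Module A V] [IsScalarTower k A V]
    [IsSimpleModule A V] [FiniteDimensional k V] [IsAlgClosed k] (f : V →ₗ[k] V) :
    ∃ a : A, ∀ v, f v = a • v := by
  have hb := IsSimpleModule.algebraMap_end_bijective_of_isAlgClosed (A := A) (V := V) k
  let g : End (End A V) V :=
    { toFun := f
      map_add' := f.map_add
      map_smul' := by
        intro c v
        obtain ⟨t, rfl⟩ := hb.2 c
        exact f.map_smul t v }
  obtain ⟨s, hs⟩ := Module.Finite.fg_top (R := k) (M := V)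
  obtain ⟨a, ha⟩ := jacobson_density g s
  refine ⟨a, fun v => ?_⟩
  have : f = Algebra.lsmul k k V a := by
    apply LinearMap.ext_on hs
    intro x hx
    exact ha x hx
  rw [this]; rfl

theorem aux_trace {A V : Type*} (k : Type*) [Field k] [Ring A] [Algebra k A] [AddCommGroup V]
    [Module k V] [Module A V] [IsScalarTower k A V]
    [IsSimpleModule A V] [FiniteDimensional k V] [IsAlgClosed k] (a b c : A)
    (h : ∀ r s t : A, LinearMap.trace k V (Algebra.lsmul k k V (r * a * s * b * t * c)) = 0)
    (ha : ∃ v : V, a • v ≠ 0) (hb : ∃ v : V, b • v ≠ 0) : ∀ v : V, c • v = 0 := by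
  by_contra! hc
  obtain ⟨u, hu⟩ := ha
  obtain ⟨v, hv⟩ := hb
  obtain ⟨w, hw⟩ := hc
  obtain ⟨f, hf⟩ := Module.Projective.exists_dual_eq_one k hu
  obtain ⟨g, hg⟩ := Module.Projective.exists_dual_eq_one k hv
  obtain ⟨l, hl⟩ := Module.Projective.exists_dual_eq_one k hw
  obtain ⟨r, hr⟩ := aux_burnside (A := A) k (f.smulRight w)
  obtain ⟨s, hs⟩ := aux_burnside (A := A) k (g.smulRight u)
  obtain ⟨t, ht⟩ := aux_burnside (A := A) k (l.smulRight v)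
  have key : Algebra.lsmul k k V (r * a * s * b * t * c) =
      (l ∘ₗ (Algebra.lsmul k k V c : V →ₗ[k] V)).smulRight w := by
    ext x
    have hsc : ∀ (z : A) (q : k) (y : V), z • q • y = q • z • y := fun z q y =>
      (Algebra.lsmul k k V z).map_smul q y
    simp only [Algebra.lsmul_coe, mul_smul, ← hr, ← hs, ← ht, LinearMap.smulRight_apply, hsc,
      hg, hf, LinearMap.comp_apply]
    simp
  have h1 := h r s t
  rw [key, LinearMap.trace_smulRight] at h1
  have h2 : l (c • w) = 0 := h1
  rw [hl] at h2
  exact one_ne_zero h2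

theorem aux_exists (A V : Type*) (k : Type*) [Field k] [Ring A] [Algebra k A] [AddCommGroup V]
    [Module k V] [Module A V] [IsScalarTower k A V] [Nontrivial V]
    [FiniteDimensional k V] [IsAlgClosed k] :
    ∃ (W : Submodule A V) (T : A →ₗ[k] k), W ≠ ⊥ ∧ (∀ x, IsNilpotent x → T x = 0) ∧
      ∀ a b c : A, (∀ r s t, T (r * a * s * b * t * c) = 0) → (∃ v ∈ W, a • v ≠ 0) →
        (∃ v ∈ W, b • v ≠ 0) → ∀ v ∈ W, c • v = 0 := by
  have : IsArtinian A V := isArtinian_of_tower k inferInstance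
  obtain ⟨W, hW⟩ := IsAtomic.exists_atom (Submodule A V)
  have hsimp : IsSimpleModule A W := isSimpleModule_iff_isAtom.2 hW
  have hfd : FiniteDimensional k W :=
    inferInstanceAs (FiniteDimensional k (W.restrictScalars k))
  refine ⟨W, LinearMap.trace k W ∘ₗ (Algebra.lsmul k k W).toLinearMap, hW.1, ?_, ?_⟩
  · intro x hx
    have h6 : IsNilpotent (Algebra.lsmul k k W x) := hx.map _
    exact (LinearMap.isNilpotent_trace_of_isNilpotent h6).eq_zero
  · rintro a b c h ⟨u, hu, hu0⟩ ⟨v, hv, hv0⟩ w hw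
    have := aux_trace (V := W) k a b c h ⟨⟨u, hu⟩, fun h => hu0 (congrArg Subtype.val h)⟩
      ⟨⟨v, hv⟩, fun h => hv0 (congrArg Subtype.val h)⟩ ⟨w, hw⟩
    exact congrArg Subtype.val this

theorem aux_span {K B : Type*} [Field K] [Ring B] [Algebra K B] (S : Set B)
    (φ : Algebra.adjoin K S →ₗ[K] K)
    (h : ∀ m (hm : m ∈ Algebra.adjoin K S), m ∈ Submonoid.closure S → φ ⟨m, hm⟩ = 0)
    (x : Algebra.adjoin K S) : φ x = 0 := by
  obtain ⟨x, hx⟩ := x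
  have hx' : x ∈ Submodule.span K (Submonoid.closure S : Set B) := by
    rw [← Algebra.adjoin_eq_span]; exact hx
  have key : ∃ hx : x ∈ Algebra.adjoin K S, φ ⟨x, hx⟩ = 0 := by
    induction hx' using Submodule.span_induction with
    | mem x h1 => exact ⟨hx, h x hx h1⟩
    | zero => exact ⟨zero_mem _, φ.map_zero⟩
    | add x y hx1 hy1 h1 h2 =>
      have e : Submodule.span K (Submonoid.closure S : Set B) =
        Subalgebra.toSubmodule (Algebra.adjoin K S) := (Algebra.adjoin_eq_span _ _).symm
      rw [e] at hx1 hy1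
      obtain ⟨p, hp⟩ := h1 hx1
      obtain ⟨q, hq⟩ := h2 hy1
      refine ⟨add_mem p q, ?_⟩
      have := φ.map_add ⟨x, p⟩ ⟨y, q⟩
      rw [hp, hq, add_zero] at this
      exact this
    | smul c x hx1 h1 =>
      have e : Submodule.span K (Submonoid.closure S : Set B) =
        Subalgebra.toSubmodule (Algebra.adjoin K S) := (Algebra.adjoin_eq_span _ _).symm
      rw [e] at hx1
      obtain ⟨p, hp⟩ := h1 hx1
      refine ⟨Subalgebra.smul_mem _ p c, ?_⟩
      have := φ.map_smul c ⟨x, p⟩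
      rw [hp, smul_zero] at this
      exact this
  exact key.2

/-- entries extended to a larger field, as an endomorphism -/
noncomputable def auxE (F K : Type*) [Field F] [Field K] [Algebra F K] (n : ℕ) :
    Matrix (Fin n) (Fin n) F →+* Module.End K (Fin n → K) :=
  (Matrix.toLinAlgEquiv' (R := K) (n := Fin n)).toRingEquiv.toRingHom.comp
    (RingHom.mapMatrix (algebraMap F K))

theorem auxE_apply (F K : Type*) [Field F] [Field K] [Algebra F K] (n : ℕ)
    (M : Matrix (Fin n) (Fin n) F) (w : Fin n → K) (i : Fin n) :
    auxE F K n M w i = ∑ j, M i j • w j := by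
  simp [auxE, Matrix.toLinAlgEquiv'_apply, Matrix.mulVec, dotProduct, Algebra.smul_def]

theorem auxE_mem (F K : Type*) [Field F] [Field K] [Algebra F K] (n : ℕ)
    (S : Set (Matrix (Fin n) (Fin n) F)) (M) (hM : M ∈ Algebra.adjoin F S) :
    auxE F K n M ∈ Algebra.adjoin K (auxE F K n '' S) := by
  induction hM using Algebra.adjoin_induction with
  | mem x hx => exact Algebra.subset_adjoin ⟨x, hx, rfl⟩
  | algebraMap r =>
    have : auxE F K n (algebraMap F _ r) = algebraMap K _ (algebraMap F K r) := by
      ext v i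
      simp [auxE_apply, Matrix.algebraMap_matrix_apply, Algebra.smul_def]
      rw [Finset.sum_eq_single i (fun b _ hb => by simp [Ne.symm hb]) (by simp), if_pos rfl]
    rw [this]; exact Subalgebra.algebraMap_mem _ _
  | add x y _ _ h1 h2 => rw [map_add]; exact add_mem h1 h2
  | mul x y _ _ h1 h2 => rw [map_mul]; exact mul_mem h1 h2

theorem aux_inj {F K : Type*} [Field F] [Field K] [Algebra F K] {n : ℕ}
    (S : Set (Matrix (Fin n) (Fin n) F))
    (hirr : ∀ W : Submodule F (Fin n → F),
      (∀ s ∈ S, ∀ x ∈ W, s.mulVec x ∈ W) → W = ⊥ ∨ W = ⊤)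
    (b : Matrix (Fin n) (Fin n) F) (w : Fin n → K) (hw : w ≠ 0)
    (h : ∀ c ∈ Algebra.adjoin F S, auxE F K n (b * c) w = 0) : b = 0 := by
  obtain ⟨i, hi⟩ := Function.ne_iff.1 hw
  obtain ⟨φ, hφ⟩ := Module.Projective.exists_dual_eq_one F hi
  let U : Submodule F (Fin n → F) :=
    { carrier := {v | ∀ c ∈ Algebra.adjoin F S, (b * c).mulVec v = 0}
      add_mem' := by
        intro x y hx hy c hc
        rw [Matrix.mulVec_add, hx c hc, hy c hc, add_zero]
      zero_mem' := by intro c hc; simp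
      smul_mem' := by
        intro t x hx c hc
        rw [Matrix.mulVec_smul, hx c hc, smul_zero] }
  have hU : U = ⊥ ∨ U = ⊤ := by
    apply hirr
    intro s hs x hx c hc
    rw [Matrix.mulVec_mulVec, mul_assoc]
    exact hx _ (mul_mem hc (Algebra.subset_adjoin hs))
  have hm : (fun j => φ (w j)) ∈ U := by
    intro c hc
    ext i
    have := congrArg φ (congrFun (h c hc) i)
    rw [auxE_apply, map_sum] at this
    simpa [Matrix.mulVec, dotProduct] using this
  rcases hU with hU | hU
  · rw [hU, Submodule.mem_bot] at hm
    have := congrFun hm i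
    exact absurd (hφ.symm.trans this) one_ne_zero
  · ext i j
    have hj : (Pi.single j 1 : Fin n → F) ∈ U := by rw [hU]; trivial
    have := congrFun (hj 1 (one_mem _)) i
    simpa using this

theorem aux_ideal {F : Type*} [Monoid F] (S J : Set F)
    (hideal : ∀ s ∈ S, ∀ j ∈ J, s * j ∈ J ∧ j * s ∈ J) (m : F) (hm : m ∈ Submonoid.closure S) :
    ∀ j ∈ J, m * j ∈ J ∧ j * m ∈ J := by
  induction hm using Submonoid.closure_induction with
  | mem x hx => exact hideal x hx
  | one => intro j hj; simpa using hj
  | mul x y _ _ h1 h2 =>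
    intro j hj
    rw [mul_assoc, ← mul_assoc j]
    exact ⟨(h1 _ (h2 j hj).1).1, (h2 _ (h1 j hj).2).2⟩

theorem aux_main (K : Type*) [Field K] [IsAlgClosed K] {F : Type*} [Field F] [Algebra F K] {n : ℕ} (hn : 1 < n)
    (e : Matrix (Fin n) (Fin n) F →+* Module.End K (Fin n → K)) (he : e = auxE F K n)
    (𝒮 : Set (Matrix (Fin n) (Fin n) F))
    (hsemi : ∀ a ∈ 𝒮, ∀ b ∈ 𝒮, a * b ∈ 𝒮)
    (hSne : ∃ S ∈ 𝒮, S ≠ 0)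
    (hirr : ∀ W : Submodule F (Fin n → F),
      (∀ S ∈ 𝒮, ∀ x ∈ W, S.mulVec x ∈ W) → W = ⊥ ∨ W = ⊤)
    (𝒥 : Set (Matrix (Fin n) (Fin n) F)) (hJS : 𝒥 ⊆ 𝒮)
    (hideal : ∀ S ∈ 𝒮, ∀ J ∈ 𝒥, S * J ∈ 𝒥 ∧ J * S ∈ 𝒥)
    (hJne : ∃ J ∈ 𝒥, J ≠ 0)
    (A : Matrix (Fin n) (Fin n) F) (hA : A ∈ Algebra.adjoin F 𝒮)
    (hnil : ∀ J₁ ∈ 𝒥, ∀ J₂ ∈ 𝒥, (J₁ * A * J₂) ^ n = 0) :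
 A = 0 := by
  classical
  have : Nonempty (Fin n) := ⟨⟨0, by omega⟩⟩
  obtain ⟨W, T, hW, hT, hmain⟩ := aux_exists (Algebra.adjoin K (e '' 𝒮)) (Fin n → K) K
  obtain ⟨J, hJ, hJ0⟩ := hJne
  have hmem : ∀ M ∈ Algebra.adjoin F 𝒮, e M ∈ (Algebra.adjoin K (e '' 𝒮)) := he ▸ auxE_mem F K n 𝒮
  have hJA : J ∈ Algebra.adjoin F 𝒮 := Algebra.subset_adjoin (hJS hJ)
  have hinj : ∀ M (hM : M ∈ Algebra.adjoin F 𝒮),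
      (∀ v ∈ W, (⟨e M, hmem M hM⟩ : (Algebra.adjoin K (e '' 𝒮))) • v = 0) → M = 0 := by
    intro M hM h
    obtain ⟨w, hw, hw0⟩ := W.exists_mem_ne_zero_of_ne_bot hW
    refine aux_inj 𝒮 hirr M w hw0 fun c hc => ?_
    rw [← he, map_mul]
    have hcw : (⟨e c, hmem c hc⟩ : (Algebra.adjoin K (e '' 𝒮))) • w ∈ W := W.smul_mem _ hw
    exact h _ hcw
  have hJW : ∃ v ∈ W, (⟨e J, hmem J hJA⟩ : (Algebra.adjoin K (e '' 𝒮))) • v ≠ 0 := by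
    by_contra! h
    exact hJ0 (hinj J hJA h)
  refine hinj A hA (hmain ⟨e J, hmem J hJA⟩ ⟨e J, hmem J hJA⟩ _ ?_ hJW hJW)
  let j : (Algebra.adjoin K (e '' 𝒮)) := ⟨e J, hmem J hJA⟩
  let a : (Algebra.adjoin K (e '' 𝒮)) := ⟨e A, hmem A hA⟩
  have hcl : ∀ m ∈ Submonoid.closure (e '' 𝒮), ∃ M ∈ Submonoid.closure 𝒮, e M = m := by
    intro m hm
    have h2 := MonoidHom.map_mclosure (e : Matrix (Fin n) (Fin n) F →* Module.End K (Fin n → K)) 𝒮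
    have : m ∈ (Submonoid.closure 𝒮).map
        (e : Matrix (Fin n) (Fin n) F →* Module.End K (Fin n → K)) := by
      rw [h2]; exact hm
    exact this
  show ∀ r s t : (Algebra.adjoin K (e '' 𝒮)), T (r * j * s * j * t * a) = 0
  intro r s t
  refine aux_span _ (T ∘ₗ LinearMap.mulRight K (j * s * j * t * a)) ?_ r |> fun h => by
    simpa [mul_assoc] using h
  intro r hr hr'
  refine aux_span _ (T ∘ₗ LinearMap.mulLeft K (⟨r, hr⟩ * j) ∘ₗ
    LinearMap.mulRight K (j * t * a)) ?_ s |> fun h => by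
    simpa [mul_assoc] using h
  intro s hs hs'
  refine aux_span _ (T ∘ₗ LinearMap.mulLeft K (⟨r, hr⟩ * j * ⟨s, hs⟩ * j) ∘ₗ
    LinearMap.mulRight K a) ?_ t |> fun h => by
    simpa [mul_assoc] using h
  intro t ht ht'
  obtain ⟨M₁, hM₁, rfl⟩ := hcl r hr'
  obtain ⟨M₂, hM₂, rfl⟩ := hcl s hs'
  obtain ⟨M₃, hM₃, rfl⟩ := hcl t ht'
  have h1 : J * M₃ ∈ 𝒥 := (aux_ideal 𝒮 𝒥 hideal M₃ hM₃ J hJ).2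
  have h2 : M₁ * J * M₂ ∈ 𝒥 :=
    (aux_ideal 𝒮 𝒥 hideal M₂ hM₂ _ (aux_ideal 𝒮 𝒥 hideal M₁ hM₁ J hJ).1).2
  have h3 := hnil _ h1 _ h2
  have h4 : ((M₁ * J * M₂) * (J * M₃ * A)) ^ (n + 1) = 0 := by
    have hp : ∀ (X Y : Matrix (Fin n) (Fin n) F) (k : ℕ),
        (X * Y) ^ (k + 1) = X * (Y * X) ^ k * Y := by
      intro X Y k
      induction k with
      | zero => simp
      | succ k ih => rw [pow_succ, ih, pow_succ (Y * X)]; simp only [mul_assoc]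
    rw [hp, h3]; simp
  have h5 : ((⟨e M₁, hr⟩ * j * ⟨e M₂, hs⟩ * j) * (⟨e M₃, ht⟩ * a) : (Algebra.adjoin K (e '' 𝒮))) ^ (n + 1) = 0 := by
    apply Subtype.ext
    have := congrArg e h4
    simpa [map_pow, map_mul, mul_assoc, j, a] using this
  show T ((⟨e M₁, hr⟩ * j * ⟨e M₂, hs⟩ * j) * (⟨e M₃, ht⟩ * a) : (Algebra.adjoin K (e '' 𝒮))) = 0
  exact hT _ ⟨n + 1, h5⟩

/-- if `𝒮` is an irreducible semigroup in `M_n(F)` (`n > 1`),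
`𝒥` a nonzero semigroup ideal of `𝒮`, and `A ∈ Alg_F(𝒮 ∪ {I})` satisfies
`(J₁ A J₂)^n = 0` for all `J₁, J₂ ∈ 𝒥`, then `A = 0`. -/
theorem stmt16 {F : Type*} [Field F] {n : ℕ} (hn : 1 < n)
    (𝒮 : Set (Matrix (Fin n) (Fin n) F))
    (hsemi : ∀ a ∈ 𝒮, ∀ b ∈ 𝒮, a * b ∈ 𝒮)
    (hSne : ∃ S ∈ 𝒮, S ≠ 0)
    (hirr : ∀ W : Submodule F (Fin n → F),
      (∀ S ∈ 𝒮, ∀ x ∈ W, S.mulVec x ∈ W) → W = ⊥ ∨ W = ⊤)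
    (𝒥 : Set (Matrix (Fin n) (Fin n) F)) (hJS : 𝒥 ⊆ 𝒮)
    (hideal : ∀ S ∈ 𝒮, ∀ J ∈ 𝒥, S * J ∈ 𝒥 ∧ J * S ∈ 𝒥)
    (hJne : ∃ J ∈ 𝒥, J ≠ 0)
    (A : Matrix (Fin n) (Fin n) F) (hA : A ∈ Algebra.adjoin F 𝒮)
    (hnil : ∀ J₁ ∈ 𝒥, ∀ J₂ ∈ 𝒥, (J₁ * A * J₂) ^ n = 0) :
    A = 0 := by
  exact aux_main (AlgebraicClosure F) hn _ rfl 𝒮 hsemi hSne hirr 𝒥 hJS hideal hJne A hA hnil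
end
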